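/- arXiv:1812.11796 — 2 statements merged into one kernel-verified Lean document; each statement's English description precedes it below -/
import Mathlib

section
/- For the double-sequence SDP with parameter m ≥ 2 and any 1 ≤ i ≤ m−1: a positive semidefinite n×n matrix Y (n = 2m+1) satisfies trace(AⱼY) = 0 for j = 1,…,i if and only if all rows and columns of Y indexed by {1,…,i} ∪ {m+1,…,m+i} are zero. -/
open Matrix

/-- `Eij n i j` : the `n×n` symmetric matrix whose only nonzero entries are `1`
in positions `(i,j)` and `(j,i)` (0-based indices). -/
def Eij (n i j : ℕ) : Matrix (Fin n) (Fin n) ℝ :=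
  Matrix.of fun a b => if (a.val = i ∧ b.val = j) ∨ (a.val = j ∧ b.val = i) then 1 else 0

/-- The constraint matrices of the double-sequence SDP with parameter `m`
(`n = 2m+1`, 0-based index `k`): `A₁ = E₁ + E_{m+1}`,
`Aᵢ = Eᵢ + E_{m+i} + E_{i-1,n} + E_{m+i-1,n}` for `i = 2, …, m-1`, and
`A_m = E_m - E_{2m} + E_{m-1,n} + E_{2m-1,n}` (1-based indices of the paper). -/
def doubleA (m : ℕ) : Fin m → Matrix (Fin (2 * m + 1)) (Fin (2 * m + 1)) ℝ := fun k =>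
  if k.val = 0 then Eij (2 * m + 1) 0 0 + Eij (2 * m + 1) m m
  else if k.val = m - 1 then
    Eij (2 * m + 1) (m - 1) (m - 1) - Eij (2 * m + 1) (2 * m - 1) (2 * m - 1) +
      Eij (2 * m + 1) (m - 2) (2 * m) + Eij (2 * m + 1) (2 * m - 2) (2 * m)
  else
    Eij (2 * m + 1) k.val k.val + Eij (2 * m + 1) (m + k.val) (m + k.val) +
      Eij (2 * m + 1) (k.val - 1) (2 * m) + Eij (2 * m + 1) (m + k.val - 1) (2 * m)

/-- A positive semidefinite matrix with a zero diagonal entry vanishes on that row and column. -/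
lemma Matrix.PosSemidef.row_col_eq_zero_of_diag_eq_zero {n : Type*} [Fintype n] [DecidableEq n]
    {A : Matrix n n ℝ} (hA : A.PosSemidef) {a : n} (ha : A a a = 0) (b : n) :
    A a b = 0 ∧ A b a = 0 := by
  have hcol : A *ᵥ Pi.single a 1 = 0 := by
    rw [← hA.dotProduct_mulVec_zero_iff]
    simpa using ha
  have hba : A b a = 0 := by simpa using congrFun hcol b
  exact ⟨by simpa using (hA.isHermitian.apply a b).symm.trans (by simpa using hba), hba⟩

lemma Eij_self_eq_single {n : ℕ} (a : Fin n) : Eij n a a = Matrix.single a a 1 := by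
  ext x y
  simp [Eij, Matrix.single_apply, Fin.ext_iff, eq_comm]

lemma Eij_eq_single_add_single {n : ℕ} {a b : Fin n} (hab : a ≠ b) :
    Eij n a b = Matrix.single a b 1 + Matrix.single b a 1 := by
  ext x y
  simp only [Eij, Matrix.of_apply, Matrix.add_apply, Matrix.single_apply, Fin.ext_iff]
  have := Fin.val_ne_of_ne hab
  split_ifs <;> first | omega | norm_num

lemma trace_Eij_self_mul {n i : ℕ} (hi : i < n) (Y : Matrix (Fin n) (Fin n) ℝ) :
    (Eij n i i * Y).trace = Y ⟨i, hi⟩ ⟨i, hi⟩ := by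
  rw [Eij_self_eq_single ⟨i, hi⟩, Matrix.trace_single_mul]
  simp

lemma trace_Eij_mul {n i j : ℕ} (hi : i < n) (hj : j < n) (hij : i ≠ j)
    (Y : Matrix (Fin n) (Fin n) ℝ) :
    (Eij n i j * Y).trace = Y ⟨j, hj⟩ ⟨i, hi⟩ + Y ⟨i, hi⟩ ⟨j, hj⟩ := by
  have hne : (⟨i, hi⟩ : Fin n) ≠ ⟨j, hj⟩ := by simpa using hij
  rw [Eij_eq_single_add_single hne, Matrix.add_mul, Matrix.trace_add,
    Matrix.trace_single_mul, Matrix.trace_single_mul]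
  simp

lemma trace_doubleA_zero_mul {m : ℕ} (hm : 0 < m)
    (Y : Matrix (Fin (2 * m + 1)) (Fin (2 * m + 1)) ℝ) :
    (doubleA m ⟨0, hm⟩ * Y).trace =
      Y ⟨0, by omega⟩ ⟨0, by omega⟩ + Y ⟨m, by omega⟩ ⟨m, by omega⟩ := by
  simp only [doubleA, if_true, Matrix.add_mul, Matrix.trace_add]
  rw [trace_Eij_self_mul (by omega), trace_Eij_self_mul (by omega)]

lemma trace_doubleA_succ_mul {m k : ℕ} (hk : k + 1 < m - 1)
    (Y : Matrix (Fin (2 * m + 1)) (Fin (2 * m + 1)) ℝ) :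
    (doubleA m ⟨k + 1, by omega⟩ * Y).trace =
      Y ⟨k + 1, by omega⟩ ⟨k + 1, by omega⟩ + Y ⟨m + (k + 1), by omega⟩ ⟨m + (k + 1), by omega⟩ +
      (Y ⟨2 * m, by omega⟩ ⟨k, by omega⟩ + Y ⟨k, by omega⟩ ⟨2 * m, by omega⟩) +
      (Y ⟨2 * m, by omega⟩ ⟨m + k, by omega⟩ + Y ⟨m + k, by omega⟩ ⟨2 * m, by omega⟩) := by
  have hpred : m + (k + 1) - 1 = m + k := by omega
  simp only [doubleA, Nat.succ_ne_zero, if_false, hk.ne, Matrix.add_mul, Matrix.trace_add,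
    Nat.add_sub_cancel, hpred]
  rw [trace_Eij_self_mul (by omega), trace_Eij_self_mul (by omega),
    trace_Eij_mul (by omega) (by omega) (by omega), trace_Eij_mul (by omega) (by omega) (by omega)]

/-- For the double-sequence SDP with parameter `m ≥ 2` and any `1 ≤ i ≤ m-1`:
a psd matrix `Y` satisfies `trace(Aⱼ Y) = 0` for `j = 1, …, i` iff all rows and
columns of `Y` indexed by `{1,…,i} ∪ {m+1,…,m+i}` (1-based) are zero. -/
theorem doubleSeq_zero_rows {m i : ℕ} (hm : 2 ≤ m) (h1 : 1 ≤ i) (h2 : i ≤ m - 1)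
    (Y : Matrix (Fin (2 * m + 1)) (Fin (2 * m + 1)) ℝ) (hY : Y.PosSemidef) :
    (∀ k : Fin m, k.val < i → ((doubleA m k) * Y).trace = 0) ↔
    (∀ a b : Fin (2 * m + 1), (a.val < i ∨ (m ≤ a.val ∧ a.val < m + i)) →
      Y a b = 0 ∧ Y b a = 0) := by
  constructor
  · intro h
    have key : ∀ k (hk : k < i), Y ⟨k, by omega⟩ ⟨k, by omega⟩ = 0 ∧
        Y ⟨m + k, by omega⟩ ⟨m + k, by omega⟩ = 0 := by
      intro k
      induction k with
      | zero =>
        intro hk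
        have ht := h ⟨0, by omega⟩ hk
        rw [trace_doubleA_zero_mul] at ht
        exact (add_eq_zero_iff_of_nonneg hY.diag_nonneg hY.diag_nonneg).1 ht
      | succ k ih =>
        intro hk
        obtain ⟨hk₁, hk₂⟩ := ih (by omega)
        have ht := h ⟨k + 1, by omega⟩ hk
        have hrow₁ := hY.row_col_eq_zero_of_diag_eq_zero hk₁ ⟨2 * m, by omega⟩
        have hrow₂ := hY.row_col_eq_zero_of_diag_eq_zero hk₂ ⟨2 * m, by omega⟩
        rw [trace_doubleA_succ_mul (by omega), hrow₁.1, hrow₁.2, hrow₂.1, hrow₂.2] at ht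
        simp only [add_zero] at ht
        exact (add_eq_zero_iff_of_nonneg hY.diag_nonneg hY.diag_nonneg).1 ht
    rintro a b (ha | ⟨ha, ha'⟩)
    · exact hY.row_col_eq_zero_of_diag_eq_zero (key a ha).1 b
    · obtain ⟨a, hlt⟩ := a
      obtain ⟨k, rfl⟩ := Nat.exists_eq_add_of_le ha
      exact hY.row_col_eq_zero_of_diag_eq_zero (key k (by simpa using ha')).2 b
  · rintro h ⟨_ | k, hkm⟩ hk
    · rw [trace_doubleA_zero_mul, (h ⟨0, _⟩ _ (Or.inl hk)).1,
        (h ⟨m, _⟩ _ (Or.inr ⟨le_rfl, Nat.lt_add_of_pos_right h1⟩)).1, add_zero]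
    · simp only at hk
      have hlow : ∀ l (hl : l < i) b, Y ⟨l, by omega⟩ b = 0 ∧ Y b ⟨l, by omega⟩ = 0 :=
        fun l hl b => h _ b (Or.inl hl)
      have hhigh : ∀ l (hl : l < i) b, Y ⟨m + l, by omega⟩ b = 0 ∧ Y b ⟨m + l, by omega⟩ = 0 :=
        fun l hl b => h _ b (Or.inr ⟨Nat.le_add_right m l, Nat.add_lt_add_left hl m⟩)
      rw [trace_doubleA_succ_mul (by omega), (hlow (k + 1) hk _).1, (hhigh (k + 1) hk _).1,
        (hlow k (by omega) _).1, (hlow k (by omega) _).2,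
        (hhigh k (by omega) _).1, (hhigh k (by omega) _).2]
      simp
end

section
/- (Key claim establishing that the singularity degree of the dual of the single-sequence SDP equals m−1.) For the single-sequence SDP with parameter n ≥ 3, let 1 ≤ i ≤ n−2 and let (Y₁,…,Y_i) be a strict facial reduction sequence for the psd cone such that every Yⱼ lies in the linear span of {A₁,…,A_{n−1}}. Then the set of positive semidefinite W with trace(YⱼW) = 0 for all j = 1,…,i is exactly 0_i ⊕ PSD^{n−i}, the set of positive semidefinite matrices whose first i rows and columns are zero. -/
open Matrix

/-- The constraint matrices of the single-sequence SDP (0-based index `k`):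
`A₁ = E₁` and `Aᵢ = Eᵢ + E_{i-1,n}` for `i = 2, …, n-1` (1-based indices of the paper). -/
def singleA (n : ℕ) : Fin (n - 1) → Matrix (Fin n) (Fin n) ℝ := fun k =>
  if k.val = 0 then Eij n 0 0 else Eij n k.val k.val + Eij n (k.val - 1) (n - 1)

/-- `(Y₁, …, Y_k)` is a strict facial reduction sequence for the `n×n` psd cone:
for each `j`, `trace(Yⱼ W) ≥ 0` for every psd `W` with `trace(Yₗ W) = 0` for all
`l < j`, and there is a psd `W` with `trace(Yₗ W) = 0` for all `l < j` and
`trace(Yⱼ W) ≠ 0`. -/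
def IsStrictFRSeq {n k : ℕ} (Y : Fin k → Matrix (Fin n) (Fin n) ℝ) : Prop :=
  ∀ j : Fin k,
    (∀ W : Matrix (Fin n) (Fin n) ℝ, W.PosSemidef →
      (∀ l : Fin k, l < j → ((Y l) * W).trace = 0) → 0 ≤ ((Y j) * W).trace) ∧
    (∃ W : Matrix (Fin n) (Fin n) ℝ, W.PosSemidef ∧
      (∀ l : Fin k, l < j → ((Y l) * W).trace = 0) ∧ ((Y j) * W).trace ≠ 0)
theorem Matrix.PosSemidef.apply_eq_zero_of_diag_eq_zero {ι : Type*} [Fintype ι]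
    {W : Matrix ι ι ℝ} (hW : W.PosSemidef) {p : ι} (hp : W p p = 0) (b : ι) :
    W p b = 0 ∧ W b p = 0 := by
  classical
  have h := (hW.dotProduct_mulVec_zero_iff (Pi.single p 1)).1 (by
    simpa [Matrix.mulVec_single_one] using hp)
  have hb : W b p = 0 := by
    simpa [Matrix.mulVec_single_one] using congrFun h b
  exact ⟨by simpa [hb] using (hW.isHermitian.apply p b).symm, hb⟩

theorem Eij_self {n : ℕ} (p : Fin n) : Eij n p p = Matrix.single p p 1 := by
  ext a b
  simp only [Eij, Matrix.of_apply, Matrix.single_apply, Fin.ext_iff]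
  exact if_congr (by omega) rfl rfl

theorem Eij_of_ne {n : ℕ} {p q : Fin n} (h : p ≠ q) :
    Eij n p q = Matrix.single p q 1 + Matrix.single q p 1 := by
  have h' : p.val ≠ q.val := Fin.val_ne_of_ne h
  ext a b
  simp only [Eij, Matrix.of_apply, Matrix.add_apply, Matrix.single_apply, Fin.ext_iff]
  split_ifs <;> first | omega | norm_num

/-- The linear functional `W ↦ trace (A_k W)` in coordinates. -/
theorem trace_singleA_mul {n : ℕ} (k : Fin (n - 1)) (W : Matrix (Fin n) (Fin n) ℝ) :
    (singleA n k * W).trace =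
      W ⟨k, by omega⟩ ⟨k, by omega⟩ +
        if k.val = 0 then 0 else
          W ⟨k - 1, by omega⟩ ⟨n - 1, by have := k.isLt; omega⟩ +
            W ⟨n - 1, by have := k.isLt; omega⟩ ⟨k - 1, by omega⟩ := by
  have hk := k.isLt
  unfold singleA
  split_ifs with h
  · have e := Eij_self (⟨k, by omega⟩ : Fin n)
    simp only [h] at e ⊢
    rw [e, Matrix.trace_single_mul]
    simp
  · have e := Eij_self (⟨k, by omega⟩ : Fin n)
    have e' := Eij_of_ne (p := (⟨k - 1, by omega⟩ : Fin n)) (q := ⟨n - 1, by omega⟩)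
      (by simp only [ne_eq, Fin.mk.injEq]; omega)
    simp only at e e'
    rw [e, e', add_mul, add_mul, Matrix.trace_add, Matrix.trace_add, Matrix.trace_single_mul,
      Matrix.trace_single_mul, Matrix.trace_single_mul]
    simp only [one_smul]
    ring

theorem trace_sum_smul_mul {n m : ℕ} (c : Fin m → ℝ) (A : Fin m → Matrix (Fin n) (Fin n) ℝ)
    (W : Matrix (Fin n) (Fin n) ℝ) :
    ((∑ k, c k • A k) * W).trace = ∑ k, c k * (A k * W).trace := by
  simp [Finset.sum_mul, Matrix.trace_sum]

/-- A matrix in the span that is nonnegative on `0_j ⊕ PSD^{n-j}` does not involve `A_k` for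
`k > j`. -/
theorem coeff_eq_zero_of_nonneg_on_face {n j : ℕ} (c : Fin (n - 1) → ℝ)
    (hpos : ∀ W : Matrix (Fin n) (Fin n) ℝ, W.PosSemidef →
      (∀ a b : Fin n, a.val < j → W a b = 0 ∧ W b a = 0) →
      0 ≤ ((∑ k, c k • singleA n k) * W).trace)
    (k : Fin (n - 1)) (hk : j < k.val) : c k = 0 := by
  by_contra hc
  have hkn := k.isLt
  let k' : Fin (n - 1) := ⟨k - 1, by omega⟩
  let s : ℝ := -(c k' + 1) / (2 * c k)
  let v : Fin n → ℝ := fun a =>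
    (if a.val = k - 1 then 1 else 0) + if a.val = n - 1 then s else 0
  have key : ((∑ l, c l • singleA n l) * Matrix.vecMulVec v v).trace = c k' + c k * (2 * s) := by
    have hterm : ∀ l : Fin (n - 1), c l * (singleA n l * Matrix.vecMulVec v v).trace =
        (if l = k' then c l else 0) + if l = k then c l * (2 * s) else 0 := by
      intro l
      have hl := l.isLt
      rw [trace_singleA_mul]
      simp only [Matrix.vecMulVec_apply, v, k', Fin.ext_iff]
      split_ifs <;> first | omega | ring
    rw [trace_sum_smul_mul, Finset.sum_congr rfl fun l _ => hterm l, Finset.sum_add_distrib]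
    simp
  have hval : c k' + c k * (2 * s) = -1 := by
    simp only [s]
    field_simp
    ring
  have h0 := hpos (Matrix.vecMulVec v v)
    (by simpa using Matrix.posSemidef_vecMulVec_self_star v)
    (by
      intro a b ha
      have hva : v a = 0 := by
        have h1 : a.val ≠ k - 1 := by omega
        have h2 : a.val ≠ n - 1 := by omega
        simp [v, h1, h2]
      simp [Matrix.vecMulVec_apply, hva])
  rw [key, hval] at h0
  norm_num at h0

/-- On `0_j ⊕ PSD^{n-j}`, a matrix of the span that is nonnegative on this face acts as a
multiple of the `j`-th diagonal entry. -/
theorem trace_mul_eq_of_nonneg_on_face {n j : ℕ} (hj : j < n - 1) (c : Fin (n - 1) → ℝ)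
    (hpos : ∀ W : Matrix (Fin n) (Fin n) ℝ, W.PosSemidef →
      (∀ a b : Fin n, a.val < j → W a b = 0 ∧ W b a = 0) →
      0 ≤ ((∑ k, c k • singleA n k) * W).trace)
    (W : Matrix (Fin n) (Fin n) ℝ)
    (hW : ∀ a b : Fin n, a.val < j → W a b = 0 ∧ W b a = 0) :
    ((∑ k, c k • singleA n k) * W).trace =
      c ⟨j, hj⟩ * W ⟨j, by omega⟩ ⟨j, by omega⟩ := by
  rw [trace_sum_smul_mul, Finset.sum_eq_single_of_mem ⟨j, hj⟩ (Finset.mem_univ _)]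
  · rw [trace_singleA_mul]
    congr 1
    split_ifs with h
    · simp
    · have := hW ⟨j - 1, by omega⟩ ⟨n - 1, by omega⟩ (by simp only at h ⊢; omega)
      simp [this.1, this.2]
  · intro l _ hl
    have hl' : l.val ≠ j := fun h => hl (Fin.ext h)
    rcases lt_or_gt_of_ne hl' with h | h
    · rw [trace_singleA_mul, (hW ⟨l, by omega⟩ ⟨l, by omega⟩ h).1]
      split_ifs with h0
      · simp
      · have := hW ⟨l - 1, by omega⟩ ⟨n - 1, by omega⟩ (by simp only; omega)
        simp [this.1, this.2]
    · rw [coeff_eq_zero_of_nonneg_on_face c hpos l h, zero_mul]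

/-- (Key claim for the singularity degree of the dual of the single-sequence SDP.)
For the single-sequence SDP with parameter `n ≥ 3`, if `1 ≤ i ≤ n-2` and
`(Y₁,…,Y_i)` is a strict facial reduction sequence for the psd cone whose members
all lie in the span of `{A₁,…,A_{n-1}}`, then the psd matrices `W` with
`trace(Yⱼ W) = 0` for all `j` are exactly those whose first `i` rows and columns
are zero: `0_i ⊕ PSD^{n-i}`. -/
theorem singleSeq_strictFR {n i : ℕ} (hn : 3 ≤ n) (h1 : 1 ≤ i) (h2 : i ≤ n - 2)
    (Y : Fin i → Matrix (Fin n) (Fin n) ℝ)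
    (hspan : ∀ j, Y j ∈ Submodule.span ℝ (Set.range (singleA n)))
    (hsfr : IsStrictFRSeq Y) :
    ∀ W : Matrix (Fin n) (Fin n) ℝ,
      (W.PosSemidef ∧ ∀ j, ((Y j) * W).trace = 0) ↔
      (W.PosSemidef ∧ ∀ a b : Fin n, a.val < i → W a b = 0 ∧ W b a = 0) := by
  have main : ∀ p ≤ i, ∀ W : Matrix (Fin n) (Fin n) ℝ, W.PosSemidef →
      ((∀ j : Fin i, j.val < p → (Y j * W).trace = 0) ↔
        ∀ a b : Fin n, a.val < p → W a b = 0 ∧ W b a = 0) := by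
    intro p
    induction p with
    | zero => intro _ W _; simp
    | succ p ih =>
      intro hp W hW
      have ih := ih (by omega)
      obtain ⟨c, hc⟩ := (Submodule.mem_span_range_iff_exists_fun ℝ).1 (hspan ⟨p, hp⟩)
      obtain ⟨hpos, V, hV, hVl, hVne⟩ := hsfr ⟨p, hp⟩
      have hformula := trace_mul_eq_of_nonneg_on_face (j := p) (by omega) c
        (fun U hU hUz => hc ▸ hpos U hU ((ih U hU).2 hUz))
      rw [hc] at hformula
      have hcp : c ⟨p, by omega⟩ ≠ 0 := by
        intro h0
        rw [hformula V ((ih V hV).1 hVl), h0, zero_mul] at hVne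
        exact hVne rfl
      constructor
      · intro h
        have hz := (ih W hW).1 fun j hj => h j (by omega)
        have hpp := h ⟨p, hp⟩ (by simp)
        rw [hformula W hz] at hpp
        have hpp := (mul_eq_zero.1 hpp).resolve_left hcp
        intro a b ha
        rcases Nat.lt_succ_iff_lt_or_eq.1 ha with ha | ha
        · exact hz a b ha
        · rw [show a = ⟨p, by omega⟩ from Fin.ext ha]
          exact hW.apply_eq_zero_of_diag_eq_zero hpp b
      · intro h j hj
        have hz : ∀ a b : Fin n, a.val < p → W a b = 0 ∧ W b a = 0 :=
          fun a b ha => h a b (by omega)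
        rcases Nat.lt_succ_iff_lt_or_eq.1 hj with hj | hj
        · exact (ih W hW).2 hz j hj
        · rw [show j = ⟨p, hp⟩ from Fin.ext hj, hformula W hz, (h ⟨p, by omega⟩ ⟨p, by omega⟩ (by simp)).1, mul_zero]
  intro W
  refine and_congr_right fun hW => ?_
  rw [← main i le_rfl W hW]
  exact ⟨fun h j _ => h j, fun h j => h j j.isLt⟩
end
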